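/- Let T = (V,E) be a tree with n ≥ 3 vertices, maximum degree Δ, V₁ = {v ∈ V' : δ(v) = 1} and V₂ = {v ∈ V' : δ(v) ≥ 2}. If 2·(√n − √(n − 1/2))·|V₂| ≥ |V₁|, then Σ_{v ∈ V'} √(3·l(v) + d(v)) ≤ Σ_{v ∈ V} 2·√(d(v) − 1) + 2·(√Δ − √(Δ − 1)). -/

import Mathlib

open Finset

namespace GraphEnergy

variable {V : Type*} [Fintype V] [DecidableEq V]

/-- The set of inner vertices: vertices of degree at least 2. -/
def innerVerts (G : SimpleGraph V) [DecidableRel G.Adj] : Finset V :=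
  univ.filter (fun v => 2 ≤ G.degree v)

/-- The number of neighbors of `v` that are leaves. -/
def leafCount (G : SimpleGraph V) [DecidableRel G.Adj] (v : V) : ℕ :=
  ((G.neighborFinset v).filter (fun w => G.degree w = 1)).card

/-- The number of neighbors of `v` of degree greater than 1. -/
def innerCount (G : SimpleGraph V) [DecidableRel G.Adj] (v : V) : ℕ :=
  ((G.neighborFinset v).filter (fun w => 1 < G.degree w)).card

/-- The auxiliary function `f(x,y) = √(4x + 4(y-1)) - √(4x + y)`. -/
noncomputable def auxf (x y : ℝ) : ℝ :=
  Real.sqrt (4 * x + 4 * (y - 1)) - Real.sqrt (4 * x + y)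

/-- Differences `√x - √(x - c)` are antitone in `x`. -/
theorem sqrt_sub_sqrt_sub_anti {A P c : ℝ} (hc : 0 ≤ c) (hA : c ≤ A) (hP : A ≤ P) :
    Real.sqrt P - Real.sqrt (P - c) ≤ Real.sqrt A - Real.sqrt (A - c) := by
  have h1 := Real.sq_sqrt (show 0 ≤ P by linarith)
  have h2 := Real.sq_sqrt (show 0 ≤ P - c by linarith)
  have h3 := Real.sq_sqrt (show 0 ≤ A by linarith)
  have h4 := Real.sq_sqrt (show 0 ≤ A - c by linarith)
  have h5 := Real.sqrt_le_sqrt hP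
  have h6 := Real.sqrt_le_sqrt (show A - c ≤ P - c by linarith)
  have h7 := Real.sqrt_le_sqrt (show P - c ≤ P by linarith)
  have h8 := Real.sqrt_nonneg (A - c)
  have h9 := Real.sqrt_le_sqrt (show A - c ≤ A by linarith)
  by_contra! h
  nlinarith

theorem leafCount_add_innerCount (G : SimpleGraph V) [DecidableRel G.Adj] (v : V) :
    leafCount G v + innerCount G v = G.degree v := by
  rw [leafCount, innerCount, ← G.card_neighborFinset_eq_degree v,
    ← card_filter_add_card_filter_not (s := G.neighborFinset v) (fun w => G.degree w = 1)]
  congr 2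
  refine filter_congr fun w hw => ?_
  have : 0 < G.degree w :=
    (G.degree_pos_iff_exists_adj w).2 ⟨v, ((G.mem_neighborFinset v w).1 hw).symm⟩
  omega

/-- In a connected graph, an inner vertex all of whose neighbors are leaves is the only inner
vertex. -/
theorem eq_of_innerCount_eq_zero {G : SimpleGraph V} [DecidableRel G.Adj]
    (hG : G.Connected) {v u : V} (hv : innerCount G v = 0) (hu : 2 ≤ G.degree u) : u = v := by
  have hleaf : ∀ w, G.Adj v w → G.degree w ≤ 1 := by
    intro w hw
    by_contra! h
    have hmem : w ∈ (G.neighborFinset v).filter (fun w => 1 < G.degree w) := by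
      simp [hw, h]
    exact (card_pos.2 ⟨w, hmem⟩).ne' hv
  have key : ∀ w, Relation.ReflTransGen G.Adj v w → w = v ∨ G.Adj v w := by
    intro w hw
    induction hw with
    | refl => exact Or.inl rfl
    | @tail b c _ hbc ih =>
      rcases ih with rfl | hvb
      · exact Or.inr hbc
      · refine Or.inl (card_le_one.1 (hleaf b hvb) c ?_ v ?_)
        · simpa using hbc
        · simpa using hvb.symm
  rcases key u ((G.reachable_iff_reflTransGen v u).1 (hG.preconnected v u)) with h | h
  · exact h
  · have := hleaf u h
    omega

theorem sqrt_le_of_innerCount_eq_one {G : SimpleGraph V} [DecidableRel G.Adj] {v : V}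
    (hv : innerCount G v = 1) :
    Real.sqrt (3 * (leafCount G v : ℝ) + (G.degree v : ℝ)) ≤
      2 * Real.sqrt ((G.degree v : ℝ) - 1) + 1 := by
  have hd : (leafCount G v : ℝ) + 1 = G.degree v := by
    exact_mod_cast hv ▸ leafCount_add_innerCount G v
  have hl : (0 : ℝ) ≤ leafCount G v := Nat.cast_nonneg _
  rw [← hd, add_sub_cancel_right]
  have := Real.sq_sqrt hl
  have := Real.sqrt_nonneg (leafCount G v : ℝ)
  refine Real.sqrt_le_iff.2 ⟨by positivity, by nlinarith⟩

theorem sqrt_le_of_two_le_innerCount {G : SimpleGraph V} [DecidableRel G.Adj] {v : V}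
    (hv : 2 ≤ innerCount G v) :
    Real.sqrt (3 * (leafCount G v : ℝ) + (G.degree v : ℝ)) ≤
      2 * Real.sqrt ((G.degree v : ℝ) - 1) -
        2 * (Real.sqrt (Fintype.card V : ℝ) - Real.sqrt ((Fintype.card V : ℝ) - 1 / 2)) := by
  have hd : (leafCount G v : ℝ) + innerCount G v = G.degree v := by
    exact_mod_cast leafCount_add_innerCount G v
  have hl : (0 : ℝ) ≤ leafCount G v := Nat.cast_nonneg _
  have hi : (2 : ℝ) ≤ innerCount G v := by exact_mod_cast hv
  have hn : (G.degree v : ℝ) ≤ Fintype.card V := by exact_mod_cast (G.degree_lt_card_verts v).le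
  have hanti := sqrt_sub_sqrt_sub_anti (A := (G.degree v : ℝ) - 1) (P := Fintype.card V)
    (c := 1 / 2) (by norm_num) (by linarith) (by linarith)
  have hle : Real.sqrt (3 * (leafCount G v : ℝ) + (G.degree v : ℝ)) ≤
      2 * Real.sqrt ((G.degree v : ℝ) - 1 - 1 / 2) := by
    refine Real.sqrt_le_iff.2 ⟨by positivity, ?_⟩
    rw [mul_pow, Real.sq_sqrt (by linarith)]
    linarith
  linarith

/-- Criterion iv): if `2(√n - √(n - 1/2))|V₂| ≥ |V₁|` for a tree on `n ≥ 3` vertices,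
then the new bound improves the Arizmendi–Dominguez bound. -/
theorem tree_criterion_iv (G : SimpleGraph V) [DecidableRel G.Adj]
    (hT : G.IsTree) (hn : 3 ≤ Fintype.card V)
    (hcond : ((((innerVerts G).filter (fun v => innerCount G v = 1)).card : ℝ)) ≤
      2 * (Real.sqrt (Fintype.card V : ℝ) - Real.sqrt ((Fintype.card V : ℝ) - 1 / 2)) *
        ((((innerVerts G).filter (fun v => 2 ≤ innerCount G v)).card : ℝ))) :
    ∑ v ∈ innerVerts G, Real.sqrt (3 * (leafCount G v : ℝ) + (G.degree v : ℝ)) ≤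
      (∑ v : V, 2 * Real.sqrt ((G.degree v : ℝ) - 1)) +
        2 * (Real.sqrt (G.maxDegree : ℝ) - Real.sqrt ((G.maxDegree : ℝ) - 1)) := by
  have hsub : ∑ v ∈ innerVerts G, 2 * Real.sqrt ((G.degree v : ℝ) - 1) ≤
      ∑ v : V, 2 * Real.sqrt ((G.degree v : ℝ) - 1) :=
    sum_le_univ_sum_of_nonneg fun v => by positivity
  by_cases h0 : ∃ v ∈ innerVerts G, innerCount G v = 0
  · obtain ⟨v, hv, hv0⟩ := h0
    have hdv : 2 ≤ G.degree v := (mem_filter.1 hv).2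
    have hin : innerVerts G = {v} := by
      refine eq_singleton_iff_unique_mem.2 ⟨hv, fun u hu => ?_⟩
      exact eq_of_innerCount_eq_zero hT.connected hv0 (mem_filter.1 hu).2
    have hmax : G.maxDegree = G.degree v := by
      have : Nonempty V := ⟨v⟩
      obtain ⟨u, hu⟩ := G.exists_maximal_degree_vertex
      have huv : u = v := eq_of_innerCount_eq_zero hT.connected hv0
        (hu ▸ hdv.trans (G.degree_le_maxDegree v))
      rw [hu, huv]
    have hl : leafCount G v = G.degree v := by
      have := leafCount_add_innerCount G v
      omega
    have hsqrt : Real.sqrt (3 * (G.degree v : ℝ) + G.degree v) =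
        2 * Real.sqrt (G.degree v : ℝ) := by
      rw [show 3 * (G.degree v : ℝ) + G.degree v = 2 ^ 2 * G.degree v by ring,
        Real.sqrt_mul (by norm_num), Real.sqrt_sq (by norm_num)]
    rw [hin, sum_singleton] at hsub ⊢
    rw [hmax, hl, hsqrt]
    linarith
  · push Not at h0
    set c := 2 * (Real.sqrt (Fintype.card V : ℝ) - Real.sqrt ((Fintype.card V : ℝ) - 1 / 2))
    have hfilter : (innerVerts G).filter (fun v => ¬ innerCount G v = 1) =
        (innerVerts G).filter (fun v => 2 ≤ innerCount G v) := by
      refine filter_congr fun v hv => ?_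
      have := h0 v hv
      omega
    have hone : ∑ v ∈ (innerVerts G).filter (fun v => innerCount G v = 1),
        Real.sqrt (3 * (leafCount G v : ℝ) + (G.degree v : ℝ)) ≤
        ∑ v ∈ (innerVerts G).filter (fun v => innerCount G v = 1),
          (2 * Real.sqrt ((G.degree v : ℝ) - 1) + 1) :=
      sum_le_sum fun v hv => sqrt_le_of_innerCount_eq_one (mem_filter.1 hv).2
    have htwo : ∑ v ∈ (innerVerts G).filter (fun v => 2 ≤ innerCount G v),
        Real.sqrt (3 * (leafCount G v : ℝ) + (G.degree v : ℝ)) ≤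
        ∑ v ∈ (innerVerts G).filter (fun v => 2 ≤ innerCount G v),
          (2 * Real.sqrt ((G.degree v : ℝ) - 1) - c) :=
      sum_le_sum fun v hv => sqrt_le_of_two_le_innerCount (mem_filter.1 hv).2
    rw [sum_add_distrib, sum_const, nsmul_eq_mul, mul_one] at hone
    rw [sum_sub_distrib, sum_const, nsmul_eq_mul] at htwo
    have hΔ : Real.sqrt ((G.maxDegree : ℝ) - 1) ≤ Real.sqrt (G.maxDegree : ℝ) :=
      Real.sqrt_le_sqrt (by linarith)
    rw [← sum_filter_add_sum_filter_not _ (fun v => innerCount G v = 1), hfilter] at hsub ⊢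
    linarith

end GraphEnergy
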